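/- arXiv:1805.02554 — 2 statements merged into one kernel-verified Lean document; each statement's English description precedes it below -/
import Mathlib

section
/- Let t be a symmetric element of F such that t ≠ ⨅ over i < n of x i and t ≠ ⨆ over i < n of x i. Then t is given by a near-unanimity term; concretely: for every lattice K, all elements u, v of K, every i : Fin n, and every lattice homomorphism φ : F → K such that φ (x i) = v and φ (x i') = u for all i' ≠ i, one has φ t = u. -/
open Cardinal

universe u

/-- A lattice `F` is freely generated by the family `x : ι → F` if the sublattice generated by
the range of `x` is all of `F` and every map from the generators into a lattice extends to a
lattice homomorphism. -/
def IsFreelyGenerated {F : Type*} [Lattice F] {ι : Type*} (x : ι → F) : Prop :=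
  latticeClosure (Set.range x) = Set.univ ∧
    ∀ (K : Type*) [Lattice K] (f : ι → K), ∃ φ : LatticeHom F K, ∀ i, φ (x i) = f i

/-- An element `u` of a lattice is symmetric if it is fixed by every automorphism. -/
def IsSymmElem {F : Type*} [Lattice F] (u : F) : Prop := ∀ π : F ≃o F, π u = u

/-- `⨅ i < n, x i`. -/
def infGen {n : ℕ} {F : Type*} [Lattice F] (hn : 3 ≤ n) (x : Fin n → F) : F :=
  Finset.univ.inf' ⟨⟨0, by omega⟩, Finset.mem_univ _⟩ x

/-- `⨆ i < n, x i`. -/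
def supGen {n : ℕ} {F : Type*} [Lattice F] (hn : 3 ≤ n) (x : Fin n → F) : F :=
  Finset.univ.sup' ⟨⟨0, by omega⟩, Finset.mem_univ _⟩ x

theorem gen_induction {F : Type*} [Lattice F] {ι : Type*} {x : ι → F}
    (hx : latticeClosure (Set.range x) = Set.univ) (p : F → Prop) (hg : ∀ i, p (x i))
    (hs : ∀ a b, p a → p b → p (a ⊔ b)) (hi : ∀ a b, p a → p b → p (a ⊓ b)) (t : F) : p t := by
  have h : latticeClosure (Set.range x) ⊆ {a | p a} := by
    apply latticeClosure_min
    · rintro _ ⟨i, rfl⟩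
      exact hg i
    · exact ⟨fun a ha b hb => hs a b ha hb, fun a ha b hb => hi a b ha hb⟩
  rw [hx] at h
  exact h (Set.mem_univ t)

/-- Lattice terms, used to bound the size of a finitely generated lattice. -/
inductive LatTerm (n : ℕ) : Type
  | var : Fin n → LatTerm n
  | sup : LatTerm n → LatTerm n → LatTerm n
  | inf : LatTerm n → LatTerm n → LatTerm n

/-- Evaluation of lattice terms. -/
def LatTerm.eval {n : ℕ} {F : Type*} [Lattice F] (x : Fin n → F) : LatTerm n → F
  | .var i => x i
  | .sup a b => a.eval x ⊔ b.eval x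
  | .inf a b => a.eval x ⊓ b.eval x

theorem small_of_gen {n : ℕ} {F : Type*} [Lattice F] {x : Fin n → F}
    (hx : latticeClosure (Set.range x) = Set.univ) : Small.{u} F := by
  apply small_of_surjective.{u} (f := LatTerm.eval x)
  intro t
  refine gen_induction hx (fun t => ∃ a, LatTerm.eval x a = t) ?_ ?_ ?_ t
  · exact fun i => ⟨.var i, rfl⟩
  · rintro _ _ ⟨a, rfl⟩ ⟨b, rfl⟩
    exact ⟨.sup a b, rfl⟩
  · rintro _ _ ⟨a, rfl⟩ ⟨b, rfl⟩
    exact ⟨.inf a b, rfl⟩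

/-- The universal property, with target `F` itself, whatever the universe levels. -/
theorem exists_endo {n : ℕ} {F : Type*} [Lattice F] {x : Fin n → F}
    (hx : IsFreelyGenerated.{_, _, u} x) (f : Fin n → F) :
    ∃ φ : LatticeHom F F, ∀ i, φ (x i) = f i := by
  have : Small.{u} F := small_of_gen hx.1
  let e : F ≃ Shrink.{u} F := equivShrink F
  let : Max (Shrink.{u} F) := ⟨fun a b => e (e.symm a ⊔ e.symm b)⟩
  let : Min (Shrink.{u} F) := ⟨fun a b => e (e.symm a ⊓ e.symm b)⟩
  let : LE (Shrink.{u} F) := ⟨fun a b => e.symm a ≤ e.symm b⟩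
  let : LT (Shrink.{u} F) := ⟨fun a b => e.symm a < e.symm b⟩
  have hs : ∀ a b : Shrink.{u} F, e.symm (a ⊔ b) = e.symm a ⊔ e.symm b :=
    fun a b => e.symm_apply_apply _
  have hi : ∀ a b : Shrink.{u} F, e.symm (a ⊓ b) = e.symm a ⊓ e.symm b :=
    fun a b => e.symm_apply_apply _
  let : Lattice (Shrink.{u} F) :=
    Function.Injective.lattice e.symm e.symm.injective Iff.rfl Iff.rfl hs hi
  obtain ⟨ψ, hψ⟩ := hx.2 (Shrink.{u} F) (fun i => e (f i))
  refine ⟨⟨⟨fun a => e.symm (ψ a), fun a b => ?_⟩, fun a b => ?_⟩, fun i => ?_⟩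
  · rw [map_sup]
    exact hs _ _
  · change e.symm (ψ (a ⊓ b)) = e.symm (ψ a) ⊓ e.symm (ψ b)
    rw [map_inf]
    exact hi _ _
  · change e.symm (ψ (x i)) = f i
    rw [hψ, e.symm_apply_apply]

theorem exists_auto {n : ℕ} {F : Type*} [Lattice F] {x : Fin n → F}
    (hx : IsFreelyGenerated.{_, _, u} x) (i j : Fin n) : ∃ π : F ≃o F, π (x i) = x j := by
  obtain ⟨φ, hφ⟩ := exists_endo hx (fun k => x (Equiv.swap i j k))
  have hinv : ∀ a, φ (φ a) = a := by
    refine gen_induction hx.1 _ ?_ ?_ ?_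
    · intro k
      rw [hφ, hφ, Equiv.swap_apply_self]
    · intro a b ha hb
      rw [map_sup, map_sup, ha, hb]
    · intro a b ha hb
      rw [map_inf, map_inf, ha, hb]
  have hm : Monotone φ := OrderHomClass.mono φ
  refine ⟨⟨⟨φ, φ, hinv, hinv⟩, fun {a b} => ⟨fun h => ?_, fun h => hm h⟩⟩, ?_⟩
  · have h2 := hm h
    change φ (φ a) ≤ φ (φ b) at h2
    rwa [hinv, hinv] at h2
  · change φ (x i) = x j
    rw [hφ, Equiv.swap_apply_left]

theorem symmetric_is_near_unanimity {n : ℕ} (hn : 3 ≤ n)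
    {F : Type*} [Lattice F] (x : Fin n → F) (hx : IsFreelyGenerated x)
    (t : F) (ht : IsSymmElem t) (ht₀ : t ≠ infGen hn x) (ht₁ : t ≠ supGen hn x) :
    ∀ (K : Type*) [Lattice K] (u v : K) (i : Fin n) (φ : LatticeHom F K),
      φ (x i) = v → (∀ i' : Fin n, i' ≠ i → φ (x i') = u) → φ t = u := by
  intro K _ u v i φ _ hu
  have hne : (Finset.univ.erase i).Nonempty := by
    rw [← Finset.card_pos, Finset.card_erase_of_mem (Finset.mem_univ i), Finset.card_univ,
      Fintype.card_fin]
    omega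
  obtain ⟨k, hk⟩ := id hne
  have hall : ∀ p : F → Prop, (∀ (π : F ≃o F) a, p a → p (π a)) → p (x i) → ∀ j, p (x j) := by
    intro p hp hi j
    obtain ⟨π, hπ⟩ := exists_auto hx i j
    rw [← hπ]
    exact hp π _ hi
  have hm : Monotone φ := OrderHomClass.mono φ
  apply le_antisymm
  · have hsplit : x i ≤ t ∨ t ≤ (Finset.univ.erase i).sup' hne x := by
      refine gen_induction hx.1 (fun t => x i ≤ t ∨ t ≤ (Finset.univ.erase i).sup' hne x)
        ?_ ?_ ?_ t
      · intro j
        by_cases h : j = i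
        · exact Or.inl (h ▸ le_rfl)
        · exact Or.inr (Finset.le_sup' x (Finset.mem_erase.2 ⟨h, Finset.mem_univ _⟩))
      · rintro a b (ha | ha) hb
        · exact Or.inl (le_sup_of_le_left ha)
        · rcases hb with hb | hb
          · exact Or.inl (le_sup_of_le_right hb)
          · exact Or.inr (sup_le ha hb)
      · rintro a b (ha | ha) hb
        · rcases hb with hb | hb
          · exact Or.inl (le_inf ha hb)
          · exact Or.inr (inf_le_of_right_le hb)
        · exact Or.inr (inf_le_of_left_le ha)
    rcases hsplit with h | h
    · exfalso
      have h' := hall (fun a => a ≤ t) (fun π a ha => by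
        have := π.monotone ha
        rwa [ht π] at this) h
      apply ht₁
      apply le_antisymm
      · refine gen_induction hx.1 (fun a => a ≤ supGen hn x) ?_ ?_ ?_ t
        · exact fun j => Finset.le_sup' x (Finset.mem_univ j)
        · exact fun a b ha hb => sup_le ha hb
        · exact fun a b ha _ => inf_le_of_left_le ha
      · exact Finset.sup'_le _ _ fun j _ => h' j
    · refine (hm h).trans ?_
      rw [map_finset_sup']
      exact Finset.sup'_le _ _ fun j hj => (hu j (Finset.ne_of_mem_erase hj)).le
  · have hsplit : t ≤ x i ∨ (Finset.univ.erase i).inf' hne x ≤ t := by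
      refine gen_induction hx.1 (fun t => t ≤ x i ∨ (Finset.univ.erase i).inf' hne x ≤ t)
        ?_ ?_ ?_ t
      · intro j
        by_cases h : j = i
        · exact Or.inl (h ▸ le_rfl)
        · exact Or.inr (Finset.inf'_le x (Finset.mem_erase.2 ⟨h, Finset.mem_univ _⟩))
      · rintro a b (ha | ha) hb
        · rcases hb with hb | hb
          · exact Or.inl (sup_le ha hb)
          · exact Or.inr (le_sup_of_le_right hb)
        · exact Or.inr (le_sup_of_le_left ha)
      · rintro a b (ha | ha) hb
        · exact Or.inl (inf_le_of_left_le ha)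
        · rcases hb with hb | hb
          · exact Or.inl (inf_le_of_right_le hb)
          · exact Or.inr (le_inf ha hb)
    rcases hsplit with h | h
    · exfalso
      have h' := hall (fun a => t ≤ a) (fun π a ha => by
        have := π.monotone ha
        rwa [ht π] at this) h
      apply ht₀
      apply le_antisymm
      · exact Finset.le_inf' _ _ fun j _ => h' j
      · refine gen_induction hx.1 (fun a => infGen hn x ≤ a) ?_ ?_ ?_ t
        · exact fun j => Finset.inf'_le x (Finset.mem_univ j)
        · exact fun a b ha _ => le_sup_of_le_left ha
        · exact fun a b ha hb => le_inf ha hb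
    · refine le_trans ?_ (hm h)
      rw [map_finset_inf']
      exact Finset.le_inf' _ _ fun j hj => (hu j (Finset.ne_of_mem_erase hj)).ge
end

section
/- The sequence j ↦ m j is strictly increasing in F, i.e. m j < m (j+1) for all j ∈ ℕ, and the sequence j ↦ (m j)̄ is strictly decreasing, i.e. (m (j+1))̄ < (m j)̄ for all j ∈ ℕ. -/
open Cardinal

universe u

/-- The image of `t` under a dual automorphism `δ : F ≃o Fᵒᵈ`, viewed back in `F`. -/
def dBar {F : Type*} [Lattice F] (δ : F ≃o Fᵒᵈ) (t : F) : F := OrderDual.ofDual (δ t)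

/-- A subset `S` of `F` is selfdually positioned (w.r.t. the dual automorphism `δ`)
if `δ '' S = S`. -/
def SelfduallyPositioned {F : Type*} [Lattice F] (δ : F ≃o Fᵒᵈ) (S : Set F) : Prop :=
  dBar δ '' S = S

/-- The elements `p i j` of `F`: `p i 0 = x i` and `p i (j+1)` is `x i` joined with the
supremum of `p i₁ j ⊓ p i₂ j` over all pairs `i₁ ≠ i₂` avoiding `i`. -/
def freeP {n : ℕ} {F : Type*} [Lattice F] (x : Fin n → F) : ℕ → Fin n → F
  | 0, i => x i
  | j + 1, i =>
    (Finset.univ.filter fun q : Fin n × Fin n => q.1 ≠ q.2 ∧ q.1 ≠ i ∧ q.2 ≠ i).fold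
      (· ⊔ ·) (x i) (fun q => freeP x j q.1 ⊓ freeP x j q.2)

/-- The element `m j`: the supremum of `p i₁ j ⊓ p i₂ j` over all pairs `i₁ ≠ i₂`. -/
def freeM {n : ℕ} {F : Type*} [Lattice F] (hn : 3 ≤ n) (x : Fin n → F) (j : ℕ) : F :=
  (Finset.univ.filter fun q : Fin n × Fin n => q.1 ≠ q.2).sup'
    ⟨(⟨0, by omega⟩, ⟨1, by omega⟩), by simp [Fin.ext_iff]⟩
    (fun q => freeP x j q.1 ⊓ freeP x j q.2)

section Helpers

variable {n : ℕ} {F : Type*} [Lattice F]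

theorem freeP_succ_le_iff (x : Fin n → F) (j : ℕ) (i : Fin n) (c : F) :
    freeP x (j + 1) i ≤ c ↔ x i ≤ c ∧ ∀ a b : Fin n, a ≠ b → a ≠ i → b ≠ i →
      freeP x j a ⊓ freeP x j b ≤ c := by
  rw [freeP]
  have h := Finset.fold_op_rel_iff_and (op := ((· ⊔ ·) : F → F → F))
    (r := fun c y => y ≤ c) (b := x i) (f := fun q : Fin n × Fin n => freeP x j q.1 ⊓ freeP x j q.2)
    (s := Finset.univ.filter fun q : Fin n × Fin n => q.1 ≠ q.2 ∧ q.1 ≠ i ∧ q.2 ≠ i)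
    (by intro x y z; exact sup_le_iff) (c := c)
  refine h.trans ?_
  simp only [Finset.mem_filter, Finset.mem_univ, true_and, Prod.forall, and_imp]

theorem freeM_le_iff (hn : 3 ≤ n) (x : Fin n → F) (j : ℕ) (c : F) :
    freeM hn x j ≤ c ↔ ∀ a b : Fin n, a ≠ b → freeP x j a ⊓ freeP x j b ≤ c := by
  refine (Finset.sup'_le_iff _ _).trans ?_
  simp only [Finset.mem_filter, Finset.mem_univ, true_and, Prod.forall]

theorem freeP_mono (x : Fin n → F) (j : ℕ) : ∀ i, freeP x j i ≤ freeP x (j + 1) i := by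
  induction j with
  | zero => intro i; exact ((freeP_succ_le_iff x 0 i _).1 le_rfl).1
  | succ j ih =>
    intro i
    rw [freeP_succ_le_iff]
    have h := (freeP_succ_le_iff x (j + 1) i _).1 le_rfl
    exact ⟨h.1, fun a b h1 h2 h3 => (inf_le_inf (ih a) (ih b)).trans (h.2 a b h1 h2 h3)⟩

theorem freeM_mono (hn : 3 ≤ n) (x : Fin n → F) (j : ℕ) :
    freeM hn x j ≤ freeM hn x (j + 1) := by
  rw [freeM_le_iff]
  intro a b hab
  exact (inf_le_inf (freeP_mono x j a) (freeP_mono x j b)).trans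
    ((freeM_le_iff hn x (j + 1) _).1 le_rfl a b hab)

theorem le_freeP (x : Fin n → F) (j : ℕ) (i : Fin n) : x i ≤ freeP x j i := by
  cases j with
  | zero => exact le_rfl
  | succ j => exact ((freeP_succ_le_iff x j i _).1 le_rfl).1

theorem map_freeP {K : Type*} [Lattice K] (φ : LatticeHom F K) (x : Fin n → F) (j : ℕ) :
    ∀ i, φ (freeP x j i) = freeP (fun i => φ (x i)) j i := by
  induction j with
  | zero => intro i; rfl
  | succ j ih =>
    intro i
    rw [freeP, freeP, ← Finset.fold_hom (op := ((· ⊔ ·) : F → F → F)) (m := φ)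
      (fun a b => map_sup φ a b)]
    simp only [map_inf, ih]

theorem map_freeM {K : Type*} [Lattice K] (φ : LatticeHom F K) (hn : 3 ≤ n) (x : Fin n → F)
    (j : ℕ) : φ (freeM hn x j) = freeM hn (fun i => φ (x i)) j := by
  refine (map_finset_sup' φ _ _).trans ?_
  refine Finset.sup'_congr _ rfl fun q _ => ?_
  simp [map_freeP]

end Helpers

section Model

universe v

/-- generator index used for producing `k` -/
def gIdx {n : ℕ} (hn : 3 ≤ n) (k : ℕ) : Fin n := ⟨(2 * k) % 3, by omega⟩

/-- home index of `k` -/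
def hIdx {n : ℕ} (hn : 3 ≤ n) (k : ℕ) : Fin n := ⟨(2 * k + 1) % 3, by omega⟩

/-- Closed subsets of the ground set: if `k` and the special point `g (k+1)` are in,
then so is `k+1`. -/
def ClosedPred {n : ℕ} (hn : 3 ≤ n) (S : Set (ULift.{v} (Fin n ⊕ ℕ))) : Prop :=
  ∀ k : ℕ, ⟨Sum.inr k⟩ ∈ S → ⟨Sum.inl (gIdx hn (k + 1))⟩ ∈ S → ⟨Sum.inr (k + 1)⟩ ∈ S

/-- The model lattice. -/
def Model {n : ℕ} (hn : 3 ≤ n) : Type v :=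
  {S : Set (ULift.{v} (Fin n ⊕ ℕ)) // ClosedPred hn S}

instance {n : ℕ} (hn : 3 ≤ n) : PartialOrder (Model.{v} hn) :=
  inferInstanceAs (PartialOrder {S : Set (ULift.{v} (Fin n ⊕ ℕ)) // ClosedPred hn S})

instance {n : ℕ} (hn : 3 ≤ n) : InfSet (Model.{v} hn) :=
  ⟨fun A => ⟨{p | ∀ S ∈ A, p ∈ S.1}, fun k h1 h2 S hS => S.2 k (h1 S hS) (h2 S hS)⟩⟩

noncomputable instance {n : ℕ} (hn : 3 ≤ n) : CompleteLattice (Model.{v} hn) :=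
  completeLatticeOfInf _ fun A =>
    ⟨fun S hS _ hp => hp S hS, fun _ hT p hp S hS => hT hS hp⟩

theorem Model.mem_inf {n : ℕ} (hn : 3 ≤ n) (S T : Model.{v} hn) (p) (h1 : p ∈ S.1)
    (h2 : p ∈ T.1) : p ∈ (S ⊓ T).1 := by
  let U : Model.{v} hn := ⟨S.1 ∩ T.1, fun k a b => ⟨S.2 k a.1 b.1, T.2 k a.2 b.2⟩⟩
  have hU : U ≤ S ⊓ T := le_inf (fun _ h => h.1) (fun _ h => h.2)
  exact hU ⟨h1, h2⟩

/-- The upper bound sets. -/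
def sSet {n : ℕ} (hn : 3 ≤ n) (j : ℕ) (i : Fin n) : Model.{v} hn :=
  ⟨{p | p.down = Sum.inl i ∨ ∃ k : ℕ, p.down = Sum.inr k ∧
      (hIdx hn k = i ∨ k < j ∨ (k = j ∧ gIdx hn j = i))}, by
    intro k h1 h2
    simp only [Set.mem_ofPred_eq, reduceCtorEq, Sum.inr.injEq, Sum.inl.injEq, false_or, false_and,
      exists_false, or_false, exists_eq_left'] at h1 h2 ⊢
    subst h2
    simp only [hIdx, gIdx, Fin.ext_iff] at h1 ⊢
    rcases h1 with h1 | h1 | ⟨h1, h3⟩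
    · omega
    · by_cases h : k + 1 = j
      · subst h; simp
      · omega
    · subst h1; omega⟩

/-- Initial segments. -/
def iSet {n : ℕ} (hn : 3 ≤ n) (j : ℕ) : Model.{v} hn :=
  ⟨{p | ∃ k : ℕ, p.down = Sum.inr k ∧ k ≤ j}, by
    intro k h1 h2
    simp at h2⟩

theorem sSet_inf {n : ℕ} (hn : 3 ≤ n) (j : ℕ) (a b : Fin n) (hab : a ≠ b) :
    sSet.{v} hn j a ⊓ sSet hn j b ≤ iSet hn j := by
  intro p hp
  have h1 := (inf_le_left : sSet.{v} hn j a ⊓ sSet hn j b ≤ _) hp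
  have h2 := (inf_le_right : sSet.{v} hn j a ⊓ sSet hn j b ≤ _) hp
  rcases p with ⟨i | k⟩
  · simp [sSet] at h1 h2
    exact absurd (h1.symm.trans h2) hab
  · simp [sSet] at h1 h2
    simp only [iSet, Set.mem_ofPred_eq, Sum.inr.injEq, exists_eq_left']
    rcases h1 with h1 | h1 | h1
    · rcases h2 with h2 | h2 | h2
      · exact absurd (h1.symm.trans h2) hab
      · omega
      · omega
    · omega
    · omega

theorem model_upper {n : ℕ} (hn : 3 ≤ n) (j : ℕ) :
    ∀ i, freeP (sSet.{v} hn 0) j i ≤ sSet hn j i := by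
  induction j with
  | zero => intro i; exact le_rfl
  | succ j ih =>
    intro i
    rw [freeP_succ_le_iff]
    constructor
    · rintro ⟨p⟩ hp
      simp only [sSet, Set.mem_ofPred_eq] at hp ⊢
      rcases hp with hp | ⟨k, hk, hp⟩
      · exact Or.inl hp
      · refine Or.inr ⟨k, hk, ?_⟩
        rcases hp with hp | hp | hp
        · exact Or.inl hp
        · omega
        · omega
    · intro a b hab _ _
      refine ((inf_le_inf (ih a) (ih b)).trans (sSet_inf hn j a b hab)).trans ?_
      rintro ⟨p⟩ ⟨k, hk, hkj⟩
      exact Or.inr ⟨k, hk, Or.inr (Or.inl (by omega))⟩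

theorem model_home {n : ℕ} (hn : 3 ≤ n) (j : ℕ) :
    ⟨Sum.inr j⟩ ∈ (freeP (sSet.{v} hn 0) j (hIdx hn j)).1 :=
  le_freeP (sSet.{v} hn 0) j (hIdx hn j) (Or.inr ⟨j, rfl, Or.inl rfl⟩)

theorem hIdx_ne {n : ℕ} (hn : 3 ≤ n) (j : ℕ) : hIdx hn j ≠ gIdx hn j := by
  simp only [hIdx, gIdx, ne_eq, Fin.ext_iff]; omega

theorem model_lower {n : ℕ} (hn : 3 ≤ n) (j : ℕ) :
    ⟨Sum.inr j⟩ ∈ (freeP (sSet.{v} hn 0) j (gIdx hn j)).1 := by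
  induction j with
  | zero => exact Or.inr ⟨0, rfl, Or.inr (Or.inr ⟨rfl, rfl⟩)⟩
  | succ j ih =>
    apply (freeP (sSet.{v} hn 0) (j + 1) (gIdx hn (j + 1))).2
    · have h := ((freeP_succ_le_iff (sSet.{v} hn 0) j (gIdx hn (j + 1)) _).1 le_rfl).2
        (hIdx hn j) (gIdx hn j) (hIdx_ne hn j)
        (by simp only [hIdx, gIdx, ne_eq, Fin.ext_iff]; omega)
        (by simp only [gIdx, ne_eq, Fin.ext_iff]; omega)
      exact h (Model.mem_inf hn _ _ _ (model_home hn j) ih)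
    · exact le_freeP (sSet.{v} hn 0) (j + 1) (gIdx hn (j + 1)) (Or.inl rfl)

theorem model_not_le {n : ℕ} (hn : 3 ≤ n) (j : ℕ) :
    ¬ freeM hn (sSet.{v} hn 0) (j + 1) ≤ freeM hn (sSet.{v} hn 0) j := by
  intro h
  have h1 : freeM hn (sSet.{v} hn 0) j ≤ iSet hn j := by
    rw [freeM_le_iff]
    intro a b hab
    exact (inf_le_inf (model_upper hn j a) (model_upper hn j b)).trans (sSet_inf hn j a b hab)
  have h2 := (freeM_le_iff hn (sSet.{v} hn 0) (j + 1) _).1 le_rfl _ _ (hIdx_ne hn (j + 1))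
  obtain ⟨k, hk, hkj⟩ := (h2.trans (h.trans h1))
    (Model.mem_inf hn _ _ _ (model_home hn (j + 1)) (model_lower hn (j + 1)))
  simp at hk
  omega

end Model

theorem freeM_strictMono {n : ℕ} (hn : 3 ≤ n)
    {F : Type*} [Lattice F] (x : Fin n → F) (hx : IsFreelyGenerated x)
    (δ : F ≃o Fᵒᵈ) (hδ : ∀ i, dBar δ (x i) = x i) :
    ∀ j : ℕ, freeM hn x j < freeM hn x (j + 1) ∧
      dBar δ (freeM hn x (j + 1)) < dBar δ (freeM hn x j) := by
  intro j
  have key : freeM hn x j < freeM hn x (j + 1) := by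
    refine lt_of_le_not_ge (freeM_mono hn x j) fun h => ?_
    obtain ⟨φ, hφ⟩ := hx.2 (Model hn) (sSet hn 0)
    have h' := OrderHomClass.mono φ h
    rw [map_freeM, map_freeM] at h'
    simp only [hφ] at h'
    exact model_not_le hn j h'
  refine ⟨key, ?_⟩
  have h := δ.strictMono key
  exact h
end
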